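/- (Proposition 3.9, variational characterization) Let R, Rμ, η be positive reals and set Θ := R/(η²Rμ). Let K denote the set of (equivalence classes of) functions w ∈ L²(ℝ) with w ≥ 0 almost everywhere, ∫ℝ w(x) dx = 1, and ∫ℝ (1+x²)·w(x) dx < ∞. For (u,v) ∈ K × K define the rescaled energy E∗(u,v) := (η²/2)∫ℝ u(x)² dx + (R/2)∫ℝ (η·u(x) + η⁻¹·v(x))² dx + (1/6)∫ℝ (u(x) + Θ·v(x))·x² dx. Then there exists a pair (F, G) ∈ K × K such that E∗(F, G) ≤ E∗(u, v) for all (u, v) ∈ K × K, the functions F and G are even (F(−x) = F(x) and G(−x) = G(x) for almost every x), and the minimizer is unique: any (F', G') ∈ K × K with E∗(F', G') ≤ E∗(u, v) for all (u, v) ∈ K × K satisfies F' = F and G' = G almost everywhere. -/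

import Mathlib

open MeasureTheory

/-- The admissible class `K`: nonnegative, square-integrable probability densities on
`ℝ` with finite second moment. -/
def MemK (w : ℝ → ℝ) : Prop :=
  Integrable w ∧ MemLp w 2 ∧ (∀ᵐ x ∂(volume : Measure ℝ), 0 ≤ w x) ∧
  (∫ x, w x) = 1 ∧ Integrable (fun x => (1 + x ^ 2) * w x)

/-- The rescaled energy functional `E∗`. -/
noncomputable def energyStar (R Rμ η : ℝ) (u v : ℝ → ℝ) : ℝ :=
  η ^ 2 / 2 * (∫ x, (u x) ^ 2) + R / 2 * (∫ x, (η * u x + η⁻¹ * v x) ^ 2)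
    + 1 / 6 * (∫ x, (u x + R / (η ^ 2 * Rμ) * v x) * x ^ 2)


/-- Quadratic part of the energy density. -/
noncomputable def quadDens (R η a b : ℝ) : ℝ := η ^ 2 / 2 * a ^ 2 + R / 2 * (η * a + η⁻¹ * b) ^ 2

/-- Energy density. -/
noncomputable def enDens (R Rμ η a b x : ℝ) : ℝ :=
  η ^ 2 / 2 * a ^ 2 + R / 2 * (η * a + η⁻¹ * b) ^ 2 + 1 / 6 * ((a + R / (η ^ 2 * Rμ) * b) * x ^ 2)

lemma quadDens_coercive (R η : ℝ) (hR : 0 < R) (hη : 0 < η) :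
    ∃ C : ℝ, 0 < C ∧ ∀ a b, a ^ 2 ≤ C * quadDens R η a b ∧ b ^ 2 ≤ C * quadDens R η a b := by
  refine ⟨2 / η ^ 2 + 4 * η ^ 2 * (1 / R + 1), by positivity, fun a b => ?_⟩
  have h1 : a ^ 2 = 2 / η ^ 2 * (η ^ 2 / 2 * a ^ 2) := by field_simp
  set s := η * a + η⁻¹ * b with hs
  have hb : b = η * (s - η * a) := by rw [hs]; field_simp; ring
  have h2 : b ^ 2 ≤ 4 * η ^ 2 * (1 / R * (R / 2 * s ^ 2) + η ^ 2 / 2 * a ^ 2) := by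
    have : 1 / R * (R / 2 * s ^ 2) = s ^ 2 / 2 := by field_simp
    rw [this, hb]
    nlinarith [mul_nonneg (sq_nonneg η) (sq_nonneg (s + η * a))]
  have e1 : 0 ≤ η ^ 2 / 2 * a ^ 2 := by positivity
  have e2 : 0 ≤ R / 2 * s ^ 2 := by positivity
  unfold quadDens
  rw [← hs]
  generalize η ^ 2 / 2 * a ^ 2 = p at *
  generalize R / 2 * s ^ 2 = q at *
  have hA : 0 < 2 / η ^ 2 := by positivity
  have hB : 0 < 4 * η ^ 2 := by positivity
  have hC : 0 < 1 / R := by positivity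
  generalize 2 / η ^ 2 = A at *
  generalize 4 * η ^ 2 = B at *
  generalize 1 / R = D at *
  constructor
  · rw [h1]
    have : 0 ≤ B * (D + 1) * (p + q) + A * q := by positivity
    nlinarith
  · have : 0 ≤ A * (p + q) + B * D * p + B * q := by positivity
    nlinarith

lemma quadDens_nonneg (R η : ℝ) (hR : 0 < R) (a b : ℝ) : 0 ≤ quadDens R η a b := by
  unfold quadDens; positivity

lemma MemK.sq {w : ℝ → ℝ} (h : MemK w) : Integrable (fun x => w x ^ 2) := h.2.1.integrable_sq

lemma MemK.mom {w : ℝ → ℝ} (h : MemK w) : Integrable (fun x => w x * x ^ 2) := by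
  refine (h.2.2.2.2.sub h.1).congr (Filter.Eventually.of_forall fun x => ?_)
  simp only [Pi.sub_apply]; ring

lemma MemK.mid {u v : ℝ → ℝ} (hu : MemK u) (hv : MemK v) : MemK (fun x => (u x + v x) / 2) := by
  refine ⟨(hu.1.add hv.1).div_const 2, ?_, ?_, ?_, ?_⟩
  · have := (hu.2.1.add hv.2.1).const_mul (1 / 2 : ℝ)
    refine this.ae_eq (Filter.Eventually.of_forall fun x => ?_)
    simp only [Pi.add_apply]; ring
  · filter_upwards [hu.2.2.1, hv.2.2.1] with x h1 h2
    positivity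
  · rw [integral_div, integral_add hu.1 hv.1, hu.2.2.2.1, hv.2.2.2.1]; norm_num
  · refine ((hu.2.2.2.2.add hv.2.2.2.2).div_const 2).congr (Filter.Eventually.of_forall fun x => ?_)
    simp only [Pi.add_apply]; ring

lemma MemK.neg_arg {u : ℝ → ℝ} (hu : MemK u) : MemK (fun x => u (-x)) := by
  have mp : MeasurePreserving (fun x : ℝ => -x) volume volume := Measure.measurePreserving_neg _
  refine ⟨hu.1.comp_neg, hu.2.1.comp_measurePreserving mp, ?_, ?_, ?_⟩
  · exact mp.quasiMeasurePreserving.ae hu.2.2.1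
  · rw [integral_neg_eq_self]; exact hu.2.2.2.1
  · refine hu.2.2.2.2.comp_neg.congr (Filter.Eventually.of_forall fun x => ?_)
    simp

lemma MemK.prod {u v : ℝ → ℝ} (hu : MemK u) (hv : MemK v) : Integrable (fun x => u x * v x) :=
  hu.2.1.integrable_mul hv.2.1

lemma int_cross {u v : ℝ → ℝ} (hu : MemK u) (hv : MemK v) (a b : ℝ) :
    Integrable (fun x => (a * u x + b * v x) ^ 2) := by
  refine (((hu.sq.const_mul (a ^ 2)).add (hv.sq.const_mul (b ^ 2))).add
    ((hu.prod hv).const_mul (2 * a * b))).congr (Filter.Eventually.of_forall fun x => ?_)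
  simp only [Pi.add_apply]; ring

lemma energy_int (R Rμ η : ℝ) {u v : ℝ → ℝ} (hu : MemK u) (hv : MemK v) :
    Integrable (fun x => enDens R Rμ η (u x) (v x) x) ∧
    energyStar R Rμ η u v = ∫ x, enDens R Rμ η (u x) (v x) x := by
  have i1 : Integrable (fun x => η ^ 2 / 2 * u x ^ 2) := hu.sq.const_mul _
  have i2 : Integrable (fun x => R / 2 * (η * u x + η⁻¹ * v x) ^ 2) :=
    (int_cross hu hv _ _).const_mul _
  have i3 : Integrable (fun x => 1 / 6 * ((u x + R / (η ^ 2 * Rμ) * v x) * x ^ 2)) := by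
    refine Integrable.const_mul ?_ _
    refine (hu.mom.add (hv.mom.const_mul (R / (η ^ 2 * Rμ)))).congr
      (Filter.Eventually.of_forall fun x => ?_)
    simp only [Pi.add_apply]; ring
  have i12 : Integrable (fun x => η ^ 2 / 2 * u x ^ 2 + R / 2 * (η * u x + η⁻¹ * v x) ^ 2) :=
    i1.add i2
  refine ⟨i12.add i3, ?_⟩
  unfold energyStar enDens
  rw [integral_add i12 i3, integral_add i1 i2, integral_const_mul, integral_const_mul,
    integral_const_mul]

lemma key_convex (R Rμ η m : ℝ)
    (hm : ∀ u v : ℝ → ℝ, MemK u → MemK v → m ≤ energyStar R Rμ η u v)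
    {u v u' v' : ℝ → ℝ} (hu : MemK u) (hv : MemK v) (hu' : MemK u') (hv' : MemK v') :
    Integrable (fun x => quadDens R η (u x - u' x) (v x - v' x)) ∧
    ∫ x, quadDens R η (u x - u' x) (v x - v' x) ≤
      2 * (energyStar R Rμ η u v + energyStar R Rμ η u' v' - 2 * m) := by
  obtain ⟨i1, e1⟩ := energy_int R Rμ η hu hv
  obtain ⟨i2, e2⟩ := energy_int R Rμ η hu' hv'
  obtain ⟨i3, e3⟩ := energy_int R Rμ η (hu.mid hu') (hv.mid hv')
  have h := hm _ _ (hu.mid hu') (hv.mid hv')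
  have heq : (fun x => quadDens R η (u x - u' x) (v x - v' x)) = fun x =>
      2 * (enDens R Rμ η (u x) (v x) x + enDens R Rμ η (u' x) (v' x) x
        - 2 * enDens R Rμ η ((u x + u' x) / 2) ((v x + v' x) / 2) x) := by
    funext x; unfold quadDens enDens; ring
  have i12 : Integrable (fun x => enDens R Rμ η (u x) (v x) x + enDens R Rμ η (u' x) (v' x) x) :=
    i1.add i2
  rw [heq]
  refine ⟨(i12.sub (i3.const_mul 2)).const_mul 2, ?_⟩
  rw [integral_const_mul, integral_sub i12 (i3.const_mul 2), integral_add i1 i2,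
    integral_const_mul, ← e1, ← e2, ← e3]
  linarith

lemma diff_sq_bound (R Rμ η m C : ℝ) (hR : 0 < R)
    (hm : ∀ u v : ℝ → ℝ, MemK u → MemK v → m ≤ energyStar R Rμ η u v) (hC0 : 0 < C)
    (hC : ∀ a b, a ^ 2 ≤ C * quadDens R η a b ∧ b ^ 2 ≤ C * quadDens R η a b)
    {u v u' v' : ℝ → ℝ} (hu : MemK u) (hv : MemK v) (hu' : MemK u') (hv' : MemK v') :
    ∫ x, (u x - u' x) ^ 2 ≤ C * (2 * (energyStar R Rμ η u v + energyStar R Rμ η u' v' - 2 * m)) ∧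
    ∫ x, (v x - v' x) ^ 2 ≤ C * (2 * (energyStar R Rμ η u v + energyStar R Rμ η u' v' - 2 * m)) := by
  obtain ⟨i, h⟩ := key_convex R Rμ η m hm hu hv hu' hv'
  have h' := mul_le_mul_of_nonneg_left h hC0.le
  rw [← integral_const_mul] at h'
  constructor
  · refine le_trans (integral_mono (hu.2.1.sub hu'.2.1).integrable_sq (i.const_mul C)
      fun x => (hC _ _).1) h'
  · refine le_trans (integral_mono (hv.2.1.sub hv'.2.1).integrable_sq (i.const_mul C)
      fun x => (hC _ _).2) h'

lemma uniq (R Rμ η : ℝ) (hR : 0 < R) (hη : 0 < η) {F G F' G' : ℝ → ℝ}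
    (hF : MemK F) (hG : MemK G) (hF' : MemK F') (hG' : MemK G')
    (h : ∀ u v : ℝ → ℝ, MemK u → MemK v → energyStar R Rμ η F G ≤ energyStar R Rμ η u v)
    (h' : energyStar R Rμ η F' G' ≤ energyStar R Rμ η F G) :
    F' =ᵐ[(volume : Measure ℝ)] F ∧ G' =ᵐ[(volume : Measure ℝ)] G := by
  obtain ⟨C, hC0, hC⟩ := quadDens_coercive R η hR hη
  obtain ⟨h1, h2⟩ := diff_sq_bound R Rμ η _ C hR h hC0 hC hF' hG' hF hG
  have h0 : C * (2 * (energyStar R Rμ η F' G' + energyStar R Rμ η F G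
      - 2 * energyStar R Rμ η F G)) ≤ 0 := by
    apply mul_nonpos_of_nonneg_of_nonpos hC0.le; linarith
  have aux : ∀ f g : ℝ → ℝ, MemK f → MemK g → ∫ x, (f x - g x) ^ 2 ≤ 0 →
      f =ᵐ[(volume : Measure ℝ)] g := by
    intro f g hf hg hfg
    have e : ∫ x, (f x - g x) ^ 2 = 0 := le_antisymm hfg (integral_nonneg fun x => sq_nonneg _)
    have hi : Integrable (fun x => (f x - g x) ^ 2) := (hf.2.1.sub hg.2.1).integrable_sq
    rw [integral_eq_zero_iff_of_nonneg (fun x => sq_nonneg _) hi] at e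
    filter_upwards [e] with x hx
    have : (f x - g x) ^ 2 = 0 := hx
    have := pow_eq_zero_iff (two_ne_zero) |>.1 this
    linarith
  exact ⟨aux _ _ hF' hF (h1.trans h0), aux _ _ hG' hG (h2.trans h0)⟩

lemma L1_small (B ε : ℝ) (hB : 0 < B) (hε : 0 < ε) :
    ∃ d > 0, ∀ f g : ℝ → ℝ, MemK f → MemK g → ∫ x, f x * x ^ 2 ≤ B → ∫ x, g x * x ^ 2 ≤ B →
      ∫ x, (f x - g x) ^ 2 ≤ d → ∫ x, |f x - g x| ≤ ε := by
  set M := Real.sqrt (6 * B / ε) with hM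
  have hMpos : 0 < M := Real.sqrt_pos.2 (by positivity)
  have hM2 : M ^ 2 = 6 * B / ε := Real.sq_sqrt (by positivity)
  set δ := ε / (6 * M) with hδ
  have hδ0 : 0 < δ := by positivity
  refine ⟨4 * δ * (ε / 3), by positivity, fun f g hf hg mf mg hd => ?_⟩
  have i1 : Integrable (Set.indicator (Set.Icc (-M) M) (fun _ : ℝ => δ)) :=
    (integrable_indicator_iff measurableSet_Icc).2 (by simp)
  have i2 : Integrable (fun x => (1 / (4 * δ)) * (f x - g x) ^ 2) :=
    (hf.2.1.sub hg.2.1).integrable_sq.const_mul _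
  have i3 : Integrable (fun x => (1 / M ^ 2) * (f x * x ^ 2 + g x * x ^ 2)) :=
    (hf.mom.add hg.mom).const_mul _
  have i12 : Integrable (fun x => Set.indicator (Set.Icc (-M) M) (fun _ : ℝ => δ) x +
    (1 / (4 * δ)) * (f x - g x) ^ 2) := i1.add i2
  have key : ∫ x, |f x - g x| ≤ ∫ x, (Set.indicator (Set.Icc (-M) M) (fun _ : ℝ => δ) x +
      (1 / (4 * δ)) * (f x - g x) ^ 2 + (1 / M ^ 2) * (f x * x ^ 2 + g x * x ^ 2)) := by
    refine integral_mono_ae (hf.1.sub hg.1).abs (i12.add i3) ?_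
    filter_upwards [hf.2.2.1, hg.2.2.1] with x h1 h2
    have p2 : 0 ≤ (1 / (4 * δ)) * (f x - g x) ^ 2 := by positivity
    have p3 : 0 ≤ (1 / M ^ 2) * (f x * x ^ 2 + g x * x ^ 2) := by positivity
    by_cases hx : x ∈ Set.Icc (-M) M
    · rw [Set.indicator_of_mem hx]
      have : |f x - g x| ≤ δ + (1 / (4 * δ)) * (f x - g x) ^ 2 := by
        rw [← sq_abs (f x - g x)]
        generalize |f x - g x| = t
        have : δ + (1 / (4 * δ)) * t ^ 2 - t = (1 / (4 * δ)) * (t - 2 * δ) ^ 2 := by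
          field_simp; ring
        have : 0 ≤ (1 / (4 * δ)) * (t - 2 * δ) ^ 2 := by positivity
        linarith
      linarith
    · rw [Set.indicator_of_notMem hx]
      have hx2 : M ^ 2 ≤ x ^ 2 := by
        have : M ≤ |x| := by
          by_contra hh
          push Not at hh
          exact hx ⟨(abs_lt.1 hh).1.le, (abs_lt.1 hh).2.le⟩
        rw [← sq_abs x]; gcongr
      have h3 : |f x - g x| ≤ f x + g x := by rw [abs_le]; constructor <;> linarith
      have h4 : f x + g x ≤ (1 / M ^ 2) * (f x * x ^ 2 + g x * x ^ 2) := by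
        rw [one_div, ← add_mul, ← div_eq_inv_mul, le_div_iff₀ (by positivity)]
        gcongr
      linarith
  refine key.trans ?_
  rw [integral_add i12 i3, integral_add i1 i2, integral_const_mul, integral_const_mul,
    integral_add hf.mom hg.mom, integral_indicator_const _ measurableSet_Icc]
  have v : volume.real (Set.Icc (-M) M) = 2 * M := by
    rw [Real.volume_real_Icc_of_le (by linarith)]; ring
  rw [v, smul_eq_mul]
  have a1 : 2 * M * δ = ε / 3 := by rw [hδ]; field_simp; norm_num
  have a2 : 1 / (4 * δ) * ∫ x, (f x - g x) ^ 2 ≤ ε / 3 := by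
    rw [one_div, ← div_eq_inv_mul, div_le_iff₀ (by positivity)]; linarith
  have a3 : 1 / M ^ 2 * (∫ x, f x * x ^ 2) + 1 / M ^ 2 * (∫ x, g x * x ^ 2) ≤ ε / 3 := by
    rw [← mul_add, one_div, ← div_eq_inv_mul, div_le_iff₀ (by positivity), hM2]
    field_simp
    linarith
  linarith

lemma L1_limit (f : ℕ → ℝ → ℝ) (hf : ∀ n, MemK (f n)) (B A : ℝ) (hB : 0 < B) (hA : 0 < A)
    (hm : ∀ n, ∫ x, f n x * x ^ 2 ≤ B)
    (hd : ∀ n k, ∫ x, (f n x - f k x) ^ 2 ≤ A * (1 / ((n : ℝ) + 1) + 1 / ((k : ℝ) + 1))) :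
    ∃ F : ℝ → ℝ, Integrable F ∧ ∫ x, F x = 1 ∧ TendstoInMeasure volume f Filter.atTop F := by
  have hc : CauchySeq (fun n => (hf n).1.toL1 (f n)) := by
    rw [Metric.cauchySeq_iff']
    intro ε hε
    obtain ⟨d, hd0, h⟩ := L1_small B (ε / 2) hB (by positivity)
    obtain ⟨N, hN⟩ := exists_nat_one_div_lt (show 0 < d / (2 * A) by positivity)
    refine ⟨N, fun n hn => ?_⟩
    have h1 := h (f n) (f N) (hf n) (hf N) (hm n) (hm N) ((hd n N).trans ?_)
    · rw [dist_eq_norm, ← Integrable.toL1_sub, L1.norm_of_fun_eq_integral_norm]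
      simp only [Pi.sub_apply, Real.norm_eq_abs]
      linarith
    · have : 1 / ((n : ℝ) + 1) ≤ 1 / ((N : ℝ) + 1) := Nat.one_div_le_one_div hn
      calc _ ≤ A * (d / (2 * A) + d / (2 * A)) := mul_le_mul_of_nonneg_left (by linarith) hA.le
        _ = d := by field_simp; norm_num
  obtain ⟨F, hF⟩ := cauchySeq_tendsto_of_complete hc
  refine ⟨F, L1.integrable_coeFn F, ?_, ?_⟩
  · have := (continuous_integral (μ := (volume : Measure ℝ)) (G := ℝ)).tendsto F |>.comp hF
    have e : ((fun a : ℝ →₁[volume] ℝ => ∫ x, a x) ∘ fun n => (hf n).1.toL1 (f n)) = fun _ => 1 := by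
      funext n
      simp only [Function.comp]
      rw [integral_congr_ae (hf n).1.coeFn_toL1, (hf n).2.2.2.1]
    rw [e] at this
    exact tendsto_nhds_unique this tendsto_const_nhds
  · have := tendstoInMeasure_of_tendsto_Lp hF
    exact this.congr_left fun n => (hf n).1.coeFn_toL1

lemma exists_memK : ∃ w, MemK w := by
  have hi : ∀ g : ℝ → ℝ, Continuous g → Integrable (Set.indicator (Set.Icc (0:ℝ) 1) g) := fun g hg =>
    (integrable_indicator_iff measurableSet_Icc).2 hg.continuousOn.integrableOn_Icc
  refine ⟨Set.indicator (Set.Icc 0 1) (fun _ => 1), hi _ continuous_const, ?_, ?_, ?_, ?_⟩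
  · exact memLp_indicator_const 2 measurableSet_Icc 1 (by simp)
  · exact Filter.Eventually.of_forall fun x => Set.indicator_nonneg (fun _ _ => zero_le_one) x
  · rw [integral_indicator_const _ measurableSet_Icc]; simp
  · refine (hi (fun x => 1 + x ^ 2) (by fun_prop)).congr (Filter.Eventually.of_forall fun x => ?_)
    by_cases hx : x ∈ Set.Icc (0:ℝ) 1 <;> simp [Set.indicator, hx]

lemma exists_min (R Rμ η : ℝ) (hR : 0 < R) (hRμ : 0 < Rμ) (hη : 0 < η) :
    ∃ F G : ℝ → ℝ, MemK F ∧ MemK G ∧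
      (∀ u v : ℝ → ℝ, MemK u → MemK v → energyStar R Rμ η F G ≤ energyStar R Rμ η u v) := by
  obtain ⟨C, hC0, hC⟩ := quadDens_coercive R η hR hη
  set Θ := R / (η ^ 2 * Rμ) with hΘ
  have hΘ0 : 0 < Θ := by positivity
  -- pointwise bounds
  have pt : ∀ a b x : ℝ, 0 ≤ a → 0 ≤ b → 0 ≤ enDens R Rμ η a b x ∧
      a ^ 2 ≤ C * enDens R Rμ η a b x ∧ b ^ 2 ≤ C * enDens R Rμ η a b x ∧
      a * x ^ 2 ≤ 6 * enDens R Rμ η a b x ∧ b * x ^ 2 ≤ 6 / Θ * enDens R Rμ η a b x := by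
    intro a b x ha hb
    have e : enDens R Rμ η a b x = quadDens R η a b + 1 / 6 * (a * x ^ 2 + Θ * (b * x ^ 2)) := by
      unfold enDens quadDens; ring
    have hq := quadDens_nonneg R η hR a b
    have p1 : 0 ≤ a * x ^ 2 := by positivity
    have p2 : 0 ≤ b * x ^ 2 := by positivity
    have p3 : 0 ≤ Θ * (b * x ^ 2) := by positivity
    have hle : quadDens R η a b ≤ enDens R Rμ η a b x := by rw [e]; linarith
    have hle' := mul_le_mul_of_nonneg_left hle hC0.le
    refine ⟨hq.trans hle, (hC a b).1.trans hle', (hC a b).2.trans hle', ?_, ?_⟩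
    · rw [e]; linarith
    · rw [div_mul_eq_mul_div, le_div_iff₀ hΘ0, e]; linarith
  set S : Set ℝ := {e | ∃ u v, MemK u ∧ MemK v ∧ energyStar R Rμ η u v = e} with hS
  have Epos : ∀ u v, MemK u → MemK v → 0 ≤ energyStar R Rμ η u v := by
    intro u v hu hv
    rw [(energy_int R Rμ η hu hv).2]
    refine integral_nonneg_of_ae ?_
    filter_upwards [hu.2.2.1, hv.2.2.1] with x h1 h2
    exact (pt _ _ _ h1 h2).1
  have hSne : S.Nonempty := by
    obtain ⟨w, hw⟩ := exists_memK
    exact ⟨_, w, w, hw, hw, rfl⟩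
  have hSb : BddBelow S := ⟨0, by rintro _ ⟨u, v, hu, hv, rfl⟩; exact Epos u v hu hv⟩
  set m := sInf S with hmdef
  have hm : ∀ u v : ℝ → ℝ, MemK u → MemK v → m ≤ energyStar R Rμ η u v := fun u v hu hv =>
    csInf_le hSb ⟨u, v, hu, hv, rfl⟩
  have hm0 : 0 ≤ m := le_csInf hSne (by rintro _ ⟨u, v, hu, hv, rfl⟩; exact Epos u v hu hv)
  have hseq : ∀ n : ℕ, ∃ u v, MemK u ∧ MemK v ∧ energyStar R Rμ η u v < m + 1 / ((n : ℝ) + 1) := by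
    intro n
    obtain ⟨_, ⟨u, v, hu, hv, rfl⟩, h⟩ :=
      exists_lt_of_csInf_lt hSne (show sInf S < m + 1 / ((n : ℝ) + 1) by
        have : 0 < 1 / ((n : ℝ) + 1) := by positivity
        linarith)
    exact ⟨u, v, hu, hv, h⟩
  choose u v hu hv hE using hseq
  have hE1 : ∀ n, energyStar R Rμ η (u n) (v n) ≤ m + 1 := by
    intro n
    have : 1 / ((n : ℝ) + 1) ≤ 1 := by
      rw [div_le_one (by positivity)]; linarith [Nat.cast_nonneg (α := ℝ) n]
    linarith [hE n]
  have hdiff : ∀ n k, C * (2 * (energyStar R Rμ η (u n) (v n) + energyStar R Rμ η (u k) (v k) - 2 * m))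
      ≤ (2 * C) * (1 / ((n : ℝ) + 1) + 1 / ((k : ℝ) + 1)) := by
    intro n k
    rw [← mul_assoc, mul_comm C 2]
    gcongr
    linarith [hE n, hE k]
  obtain ⟨F, iF, F1, tF⟩ := L1_limit u hu (6 * (m + 1)) (2 * C) (by positivity) (by positivity)
    (fun n => by
      obtain ⟨i, e⟩ := energy_int R Rμ η (hu n) (hv n)
      refine le_trans ?_ (mul_le_mul_of_nonneg_left (hE1 n) (by norm_num))
      rw [e, ← integral_const_mul]
      refine integral_mono_ae (hu n).mom (i.const_mul _) ?_
      filter_upwards [(hu n).2.2.1, (hv n).2.2.1] with x h1 h2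
      exact (pt _ _ _ h1 h2).2.2.2.1)
    (fun n k => (diff_sq_bound R Rμ η m C hR hm hC0 hC (hu n) (hv n) (hu k) (hv k)).1.trans
      (hdiff n k))
  obtain ⟨G, iG, G1, tG⟩ := L1_limit v hv (6 / Θ * (m + 1)) (2 * C) (by positivity) (by positivity)
    (fun n => by
      obtain ⟨i, e⟩ := energy_int R Rμ η (hu n) (hv n)
      refine le_trans ?_ (mul_le_mul_of_nonneg_left (hE1 n) (by positivity))
      rw [e, ← integral_const_mul]
      refine integral_mono_ae (hv n).mom (i.const_mul _) ?_
      filter_upwards [(hu n).2.2.1, (hv n).2.2.1] with x h1 h2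
      exact (pt _ _ _ h1 h2).2.2.2.2)
    (fun n k => (diff_sq_bound R Rμ η m C hR hm hC0 hC (hu n) (hv n) (hu k) (hv k)).2.trans
      (hdiff n k))
  obtain ⟨φ, hφ, aF⟩ := tF.exists_seq_tendsto_ae
  have tG' : TendstoInMeasure volume (fun n => v (φ n)) Filter.atTop G :=
    fun ε hε => (tG ε hε).comp hφ.tendsto_atTop
  obtain ⟨ψ, hψ, aG⟩ := tG'.exists_seq_tendsto_ae
  have hu0 : ∀ᵐ x ∂(volume : Measure ℝ), ∀ n, 0 ≤ u n x := ae_all_iff.2 fun n => (hu n).2.2.1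
  have hv0 : ∀ᵐ x ∂(volume : Measure ℝ), ∀ n, 0 ≤ v n x := ae_all_iff.2 fun n => (hv n).2.2.1
  have F0 : ∀ᵐ x ∂(volume : Measure ℝ), 0 ≤ F x := by
    filter_upwards [aF, hu0] with x h1 h2
    exact ge_of_tendsto' h1 fun n => h2 _
  have G0 : ∀ᵐ x ∂(volume : Measure ℝ), 0 ≤ G x := by
    filter_upwards [aG, hv0] with x h1 h2
    exact ge_of_tendsto' h1 fun n => h2 _
  have hmeas : ∀ f g : ℝ → ℝ, AEStronglyMeasurable f volume → AEStronglyMeasurable g volume →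
      AEStronglyMeasurable (fun x => enDens R Rμ η (f x) (g x) x) volume := by
    intro f g hf hg
    have : Continuous (fun p : (ℝ × ℝ) × ℝ => enDens R Rμ η p.1.1 p.1.2 p.2) := by
      unfold enDens; fun_prop
    exact this.comp_aestronglyMeasurable ((hf.prodMk hg).prodMk aestronglyMeasurable_id)
  have mFG := hmeas F G iF.1 iG.1
  have D0 : 0 ≤ᵐ[(volume : Measure ℝ)] fun x => enDens R Rμ η (F x) (G x) x := by
    filter_upwards [F0, G0] with x h1 h2
    exact (pt _ _ _ h1 h2).1
  set ρ := fun n => φ (ψ n) with hρ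
  have hρt : Filter.Tendsto ρ Filter.atTop Filter.atTop :=
    hφ.tendsto_atTop.comp hψ.tendsto_atTop
  -- Fatou
  have fatou : ∫⁻ x, ENNReal.ofReal (enDens R Rμ η (F x) (G x) x) ≤ ENNReal.ofReal m := by
    have l1 : ∫⁻ x, ENNReal.ofReal (enDens R Rμ η (F x) (G x) x) ≤
        ∫⁻ x, Filter.liminf (fun n =>
          ENNReal.ofReal (enDens R Rμ η (u (ρ n) x) (v (ρ n) x) x)) Filter.atTop := by
      refine lintegral_mono_ae ?_
      filter_upwards [aF, aG] with x h1 h2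
      have h1' := h1.comp hψ.tendsto_atTop
      have hcont : Continuous (fun p : ℝ × ℝ => ENNReal.ofReal (enDens R Rμ η p.1 p.2 x)) := by
        refine ENNReal.continuous_ofReal.comp ?_
        unfold enDens; fun_prop
      have := (hcont.tendsto (F x, G x)).comp (h1'.prodMk_nhds h2)
      exact this.liminf_eq.ge
    refine l1.trans ((lintegral_liminf_le' fun n =>
      (hmeas _ _ (hu _).1.1 (hv _).1.1).aemeasurable.ennreal_ofReal).trans ?_)
    have e : ∀ n, ∫⁻ x, ENNReal.ofReal (enDens R Rμ η (u (ρ n) x) (v (ρ n) x) x)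
        = ENNReal.ofReal (energyStar R Rμ η (u (ρ n)) (v (ρ n))) := by
      intro n
      obtain ⟨i, e⟩ := energy_int R Rμ η (hu (ρ n)) (hv (ρ n))
      rw [e, ofReal_integral_eq_lintegral_ofReal i]
      filter_upwards [(hu (ρ n)).2.2.1, (hv (ρ n)).2.2.1] with x h1 h2
      exact (pt _ _ _ h1 h2).1
    simp_rw [e]
    have t : Filter.Tendsto (fun n => energyStar R Rμ η (u n) (v n)) Filter.atTop (nhds m) := by
      have t2 : Filter.Tendsto (fun n : ℕ => m + 1 / ((n : ℝ) + 1)) Filter.atTop (nhds m) := by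
        simpa using (tendsto_const_nhds (x := m)).add (tendsto_one_div_add_atTop_nhds_zero_nat (𝕜 := ℝ))
      exact tendsto_of_tendsto_of_tendsto_of_le_of_le tendsto_const_nhds t2
        (fun n => hm _ _ (hu n) (hv n)) (fun n => (hE n).le)
    exact ((ENNReal.continuous_ofReal.tendsto m).comp (t.comp hρt)).liminf_eq.le
  have iD : Integrable (fun x => enDens R Rμ η (F x) (G x) x) := by
    refine ⟨mFG, ?_⟩
    rw [hasFiniteIntegral_iff_ofReal D0]
    exact fatou.trans_lt ENNReal.ofReal_lt_top
  have mk : ∀ (f : ℝ → ℝ) (c : ℝ), Integrable f → (∀ᵐ x ∂(volume : Measure ℝ), 0 ≤ f x) →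
      ∫ x, f x = 1 → (∀ᵐ x ∂(volume : Measure ℝ), f x ^ 2 ≤ C * enDens R Rμ η (F x) (G x) x) →
      (∀ᵐ x ∂(volume : Measure ℝ), f x * x ^ 2 ≤ c * enDens R Rμ η (F x) (G x) x) → MemK f := by
    intro f c hf f0 f1 h1 h2
    refine ⟨hf, ?_, f0, f1, ?_⟩
    · rw [memLp_two_iff_integrable_sq hf.1]
      refine (iD.const_mul C).mono' (hf.1.pow 2) ?_
      filter_upwards [h1] with x hx
      rw [Real.norm_of_nonneg (sq_nonneg _)]; exact hx
    · have : Integrable (fun x => f x * x ^ 2) := by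
        refine (iD.const_mul c).mono' (hf.1.mul (by fun_prop)) ?_
        filter_upwards [h2, f0] with x hx hx0
        rw [Real.norm_of_nonneg (by positivity)]; exact hx
      refine (hf.add this).congr (Filter.Eventually.of_forall fun x => ?_)
      simp only [Pi.add_apply]; ring
  have KF : MemK F := mk F 6 iF F0 F1
    (by filter_upwards [F0, G0] with x h1 h2 using (pt _ _ _ h1 h2).2.1)
    (by filter_upwards [F0, G0] with x h1 h2 using (pt _ _ _ h1 h2).2.2.2.1)
  have KG : MemK G := mk G (6 / Θ) iG G0 G1
    (by filter_upwards [F0, G0] with x h1 h2 using (pt _ _ _ h1 h2).2.2.1)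
    (by filter_upwards [F0, G0] with x h1 h2 using (pt _ _ _ h1 h2).2.2.2.2)
  refine ⟨F, G, KF, KG, fun u v hu hv => le_trans ?_ (hm u v hu hv)⟩
  rw [(energy_int R Rμ η KF KG).2, ← ENNReal.ofReal_le_ofReal_iff hm0,
    ofReal_integral_eq_lintegral_ofReal iD D0]
  exact fatou

/-- Proposition 3.9: the rescaled energy `E∗` has a unique minimizer in `K × K`, and
this minimizer is even. -/
theorem energyStar_exists_unique_minimizer (R Rμ η : ℝ)
    (hR : 0 < R) (hRμ : 0 < Rμ) (hη : 0 < η) :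
    ∃ F G : ℝ → ℝ, MemK F ∧ MemK G ∧
      (∀ u v : ℝ → ℝ, MemK u → MemK v → energyStar R Rμ η F G ≤ energyStar R Rμ η u v) ∧
      (∀ᵐ x ∂(volume : Measure ℝ), F (-x) = F x) ∧
      (∀ᵐ x ∂(volume : Measure ℝ), G (-x) = G x) ∧
      (∀ F' G' : ℝ → ℝ, MemK F' → MemK G' →
        (∀ u v : ℝ → ℝ, MemK u → MemK v →
          energyStar R Rμ η F' G' ≤ energyStar R Rμ η u v) →
        F' =ᵐ[(volume : Measure ℝ)] F ∧ G' =ᵐ[(volume : Measure ℝ)] G) := by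
  obtain ⟨F, G, hF, hG, h⟩ := exists_min R Rμ η hR hRμ hη
  have hn : energyStar R Rμ η (fun x => F (-x)) (fun x => G (-x)) ≤ energyStar R Rμ η F G := by
    rw [(energy_int R Rμ η hF hG).2, (energy_int R Rμ η hF.neg_arg hG.neg_arg).2,
      ← integral_neg_eq_self (fun x => enDens R Rμ η (F x) (G x) x)]
    simp [enDens]
  obtain ⟨e1, e2⟩ := uniq R Rμ η hR hη hF hG hF.neg_arg hG.neg_arg h hn
  exact ⟨F, G, hF, hG, h, e1, e2, fun F' G' hF' hG' h' =>
    uniq R Rμ η hR hη hF hG hF' hG' h (h' F G hF hG)⟩
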